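/- For every odd integer n > 1, sum_{k=0}^{(n+1)/2} [4k-1] (q^{-2};q^4)_k^2 / (q^4;q^4)_k^2 · q^{4k} ≡ -q^n(1-q+q^2) [n]_{q^2}^2 (mod [n]_{q^2}^2 Φ_n(q^2)). -/

import Mathlib

open RatFunc

noncomputable def q : RatFunc ℚ := RatFunc.X

/-- q-shifted factorial `(a;b)_m = ∏_{j=0}^{m-1} (1 - a b^j)`. -/
noncomputable def qpoch (a b : RatFunc ℚ) (m : ℕ) : RatFunc ℚ :=
  ∏ j ∈ Finset.range m, (1 - a * b ^ j)

/-- q-integer `[m] = (1-q^m)/(1-q)` for an arbitrary integer `m`. -/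
noncomputable def qintZ (m : ℤ) : RatFunc ℚ := (1 - q ^ m) / (1 - q)

/-- q-integer `[m] = 1 + q + ⋯ + q^{m-1}`. -/
noncomputable def qint (m : ℕ) : RatFunc ℚ := ∑ i ∈ Finset.range m, q ^ i

/-- q-binomial coefficient `(q;q)_n / ((q;q)_k (q;q)_{n-k})`. -/
noncomputable def qbinom (n k : ℕ) : RatFunc ℚ :=
  qpoch q q n / (qpoch q q k * qpoch q q (n - k))

/-- the polynomial `[n]_{q²} = 1 + q² + ⋯ + q^{2(n-1)}` in `ℚ[q]` -/
noncomputable def qintP2 (n : ℕ) : Polynomial ℚ := ∑ i ∈ Finset.range n, Polynomial.X ^ (2 * i)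

/-- the rational function `[n]_{q²} = 1 + q² + ⋯ + q^{2(n-1)}` -/
noncomputable def qint2 (n : ℕ) : RatFunc ℚ := ∑ i ∈ Finset.range n, q ^ (2 * i)

/-- the polynomial `Φ_n(q²)` in `ℚ[q]` -/
noncomputable def cyclo2 (n : ℕ) : Polynomial ℚ :=
  (Polynomial.cyclotomic n ℚ).comp (Polynomial.X ^ 2)

open Polynomial in
theorem isCoprime_of_forall_complex_root {f g : ℚ[X]}
    (h : ∀ z : ℂ, aeval z f = 0 → aeval z g ≠ 0) : IsCoprime f g := by
  rw [Polynomial.isCoprime_iff_aeval_ne_zero_of_isAlgClosed ℚ ℂ]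
  intro z
  by_cases hz : aeval z f = 0
  · exact Or.inr (h z hz)
  · exact Or.inl hz

theorem prod_one_sub_pow_odd {R : Type*} [CommRing R] (x : R) (m : ℕ) (h : x ^ (2 * m + 1) = 1) :
    ∏ j ∈ Finset.range m, (1 - x ^ (2 * j + 1)) =
      (-1) ^ m * x ^ m ^ 2 * ∏ j ∈ Finset.range m, (1 - x ^ (2 * j + 2)) := by
  have hexp : ∏ j ∈ Finset.range m, x ^ (2 * j + 1) = x ^ m ^ 2 := by
    clear h
    induction m with
    | zero => simp
    | succ m ih => rw [Finset.prod_range_succ, ih]; ring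
  have hterm : ∀ j ∈ Finset.range m,
      1 - x ^ (2 * j + 1) = (-1) * x ^ (2 * j + 1) * (1 - x ^ (2 * (m - 1 - j) + 2)) := by
    intro j hj
    have hj' := Finset.mem_range.mp hj
    have : x ^ (2 * j + 1) * x ^ (2 * (m - 1 - j) + 2) = 1 := by
      rw [← pow_add, ← h]; congr 1; omega
    linear_combination -this
  rw [Finset.prod_congr rfl hterm, Finset.prod_mul_distrib, Finset.prod_mul_distrib, hexp,
    Finset.prod_range_reflect (fun j => 1 - x ^ (2 * j + 2)) m]
  simp

theorem sq_prod_one_sub_pow_odd {R : Type*} [CommRing R] (y : R) (m : ℕ)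
    (h : y ^ (2 * (2 * m + 1)) = 1) :
    (∏ j ∈ Finset.range m, (1 - (y ^ 2) ^ (2 * j + 1))) ^ 2 =
      y ^ (2 * m + 2) * (∏ j ∈ Finset.range m, (1 - (y ^ 2) ^ (2 * j + 2))) ^ 2 := by
  rw [prod_one_sub_pow_odd (y ^ 2) m (by rw [← pow_mul, h]), mul_pow, mul_pow]
  have hsign : ((-1 : R) ^ m) ^ 2 = 1 := by rw [← pow_mul, mul_comm, pow_mul]; simp
  have hpow : ((y ^ 2) ^ m ^ 2) ^ 2 = y ^ (2 * m + 2) := by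
    calc ((y ^ 2) ^ m ^ 2) ^ 2 = ((y ^ 2) ^ m ^ 2) ^ 2 * y ^ (2 * (2 * m + 1)) := by rw [h, mul_one]
      _ = y ^ (2 * m + 2) * (y ^ (2 * (2 * m + 1))) ^ m := by ring
      _ = y ^ (2 * m + 2) := by rw [h]; simp
  rw [hsign, hpow, one_mul]

/-- The product of two `q`-factorials divides the `q`-factorial of the sum. -/
theorem prod_one_sub_pow_mul_dvd {R : Type*} [CommRing R] (x : R) (a b : ℕ) :
    (∏ j ∈ Finset.range a, (1 - x ^ (j + 1))) * ∏ j ∈ Finset.range b, (1 - x ^ (j + 1)) ∣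
      ∏ j ∈ Finset.range (a + b), (1 - x ^ (j + 1)) := by
  induction a generalizing b with
  | zero => simp
  | succ a iha =>
    induction b with
    | zero => simp
    | succ b ihb =>
      obtain ⟨c, hc⟩ := iha (b + 1)
      obtain ⟨d, hd⟩ := ihb
      rw [show a + (b + 1) = a + b + 1 by ring] at hc
      rw [show a + 1 + b = a + b + 1 by ring] at hd
      refine ⟨c + x ^ (a + 1) * d, ?_⟩
      rw [show a + 1 + (b + 1) = a + b + 1 + 1 by ring, Finset.prod_range_succ]
      rw [Finset.prod_range_succ _ b] at hc
      rw [Finset.prod_range_succ _ a] at hd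
      rw [Finset.prod_range_succ _ a, Finset.prod_range_succ _ b]
      linear_combination (1 - x ^ (a + 1)) * hc + x ^ (a + 1) * (1 - x ^ (b + 1)) * hd

theorem prod_one_sub_pow_two_mul {R : Type*} [CommRing R] (x : R) (m : ℕ) :
    ∏ j ∈ Finset.range (m + m), (1 - x ^ (j + 1)) =
      (∏ j ∈ Finset.range m, (1 - x ^ (2 * j + 1))) *
        ∏ j ∈ Finset.range m, (1 - x ^ (2 * j + 2)) := by
  induction m with
  | zero => simp
  | succ m ih =>
    rw [show m + 1 + (m + 1) = m + m + 1 + 1 by ring, Finset.prod_range_succ,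
      Finset.prod_range_succ, ih, Finset.prod_range_succ, Finset.prod_range_succ]
    ring

theorem prod_one_sub_pow_even {R : Type*} [CommRing R] (x : R) (m : ℕ) :
    ∏ j ∈ Finset.range m, (1 - x ^ (2 * j + 2)) =
      (∏ j ∈ Finset.range m, (1 - x ^ (j + 1))) * ∏ j ∈ Finset.range m, (1 + x ^ (j + 1)) := by
  rw [← Finset.prod_mul_distrib]
  exact Finset.prod_congr rfl fun j _ => by ring

theorem one_sub_X_sq_pow_ne_zero (k : ℕ) :
    (1 - (Polynomial.X ^ 2) ^ (k + 1) : Polynomial ℚ) ≠ 0 := by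
  intro h
  have := congrArg (Polynomial.eval 0) h
  simp at this

theorem q_ne_zero : q ≠ 0 := RatFunc.X_ne_zero

theorem algebraMap_X_eq_q : algebraMap (Polynomial ℚ) (RatFunc ℚ) Polynomial.X = q :=
  RatFunc.algebraMap_X

theorem one_sub_q_pow_ne_zero (k : ℕ) : 1 - q ^ (k + 1) ≠ 0 := by
  rw [← algebraMap_X_eq_q, ← map_one (algebraMap (Polynomial ℚ) (RatFunc ℚ)), ← map_pow, ← map_sub]
  refine RatFunc.algebraMap_ne_zero fun h => ?_
  have := congrArg (Polynomial.eval 0) h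
  simp at this

theorem one_add_q_ne_zero : 1 + q ≠ 0 := by
  intro h
  exact one_sub_q_pow_ne_zero 1 (by linear_combination (1 - q) * h)

theorem qpoch_succ (a b : RatFunc ℚ) (m : ℕ) : qpoch a b (m + 1) = qpoch a b m * (1 - a * b ^ m) :=
  Finset.prod_range_succ _ _

theorem qpoch_q_four_ne_zero (m : ℕ) : qpoch (q ^ 4) (q ^ 4) m ≠ 0 := by
  refine Finset.prod_ne_zero_iff.mpr fun j _ => ?_
  have := one_sub_q_pow_ne_zero (4 * j + 3)
  convert this using 2
  ring

theorem qpoch_q_inv_sq_succ (m : ℕ) :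
    qpoch (q⁻¹ ^ 2) (q ^ 4) (m + 1) = (1 - q⁻¹ ^ 2) * qpoch (q ^ 2) (q ^ 4) m := by
  have hq := q_ne_zero
  unfold qpoch
  rw [Finset.prod_range_succ', mul_comm]
  congr 1
  · simp
  · refine Finset.prod_congr rfl fun j _ => ?_
    field_simp
    ring

theorem sum_qintZ_mul_qpoch (M : ℕ) :
    ∑ k ∈ Finset.range (M + 1),
        qintZ (4 * k - 1) * qpoch (q⁻¹ ^ 2) (q ^ 4) k ^ 2 / qpoch (q ^ 4) (q ^ 4) k ^ 2 *
          q ^ (4 * k) =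
      -(1 + q ^ (4 * M + 1)) / (q * (1 + q)) *
        (qpoch (q ^ 2) (q ^ 4) M ^ 2 / qpoch (q ^ 4) (q ^ 4) M ^ 2) := by
  have hq := q_ne_zero
  have h1 : 1 - q ≠ 0 := by simpa using one_sub_q_pow_ne_zero 0
  have h2 := one_add_q_ne_zero
  induction M with
  | zero =>
    simp only [qintZ, qpoch]
    simp
    field_simp
    ring
  | succ M ih =>
    have hz : qintZ (4 * ((M + 1 : ℕ) : ℤ) - 1) = (1 - q ^ (4 * M + 3)) / (1 - q) := by
      rw [qintZ, show (4 * ((M + 1 : ℕ) : ℤ) - 1) = ((4 * M + 3 : ℕ) : ℤ) by push_cast; ring,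
        zpow_natCast]
    have hP := qpoch_q_four_ne_zero M
    have hP' : 1 - q ^ 4 * (q ^ 4) ^ M ≠ 0 := by
      have := one_sub_q_pow_ne_zero (4 * M + 3)
      convert this using 2
      ring
    rw [Finset.sum_range_succ, ih, hz, qpoch_q_inv_sq_succ, qpoch_succ, qpoch_succ]
    generalize qpoch (q ^ 2) (q ^ 4) M = O
    generalize qpoch (q ^ 4) (q ^ 4) M = P at *
    rw [show q ^ (4 * M + 1) = (q ^ 4) ^ M * q by ring,
      show q ^ (4 * M + 3) = (q ^ 4) ^ M * q ^ 3 by ring,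
      show q ^ (4 * (M + 1)) = (q ^ 4) ^ M * q ^ 4 by ring,
      show q ^ (4 * (M + 1) + 1) = (q ^ 4) ^ M * q ^ 5 by ring]
    generalize (q ^ 4) ^ M = u at *
    obtain ⟨v, hv⟩ : ∃ v, v = 1 - q ^ 4 * u := ⟨_, rfl⟩
    rw [← hv] at hP' ⊢
    field_simp
    rw [hv]
    ring

theorem qintP2_mul (n : ℕ) :
    qintP2 n * (1 - Polynomial.X ^ 2) = 1 - Polynomial.X ^ (2 * n) := by
  simp only [qintP2, pow_mul]
  exact geom_sum_mul_neg _ _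

theorem cyclo2_dvd_qintP2 {n : ℕ} (hn : 1 < n) : cyclo2 n ∣ qintP2 n := by
  obtain ⟨c, hc⟩ := Polynomial.cyclotomic_dvd_geom_sum_of_dvd ℚ (dvd_refl n) hn.ne'
  refine ⟨c.comp (Polynomial.X ^ 2), ?_⟩
  rw [cyclo2, ← Polynomial.mul_comp, ← hc, qintP2]
  simp [pow_mul]

theorem isCoprime_cyclo2_prod (m : ℕ) :
    IsCoprime (cyclo2 (2 * m + 1))
      (∏ j ∈ Finset.range m, (1 - (Polynomial.X ^ 2) ^ (2 * j + 2))) := by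
  refine isCoprime_of_forall_complex_root fun z hz => ?_
  have hroot : (Polynomial.cyclotomic (2 * m + 1) ℂ).IsRoot (z ^ 2) := by
    rw [← Polynomial.map_cyclotomic (2 * m + 1) (algebraMap ℚ ℂ), Polynomial.IsRoot.def,
      Polynomial.eval_map_algebraMap]
    simpa [cyclo2, Polynomial.aeval_comp] using hz
  have hprim := Polynomial.isRoot_cyclotomic_iff.mp hroot
  rw [map_prod]
  refine Finset.prod_ne_zero_iff.mpr fun j hj h0 => ?_
  have hj' := Finset.mem_range.mp hj
  have h1 : (z ^ 2) ^ (2 * j + 2) = 1 := by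
    simp only [map_sub, map_one, map_pow, Polynomial.aeval_X] at h0
    linear_combination -h0
  have := Nat.le_of_dvd (by omega) (hprim.dvd_of_pow_eq_one _ h1)
  omega

theorem isCoprime_denominator {n : ℕ} (hn : Odd n) (hn1 : 1 < n) (m : ℕ) :
    IsCoprime (Polynomial.X * (1 + Polynomial.X) * qintP2 (n + 1) ^ 2 *
        (∏ j ∈ Finset.range m, (1 + (Polynomial.X ^ 2) ^ (j + 1))) ^ 4)
      (qintP2 n * cyclo2 n) := by
  refine (isCoprime_of_forall_complex_root fun z hz hD => ?_).symm
  have hs : Polynomial.aeval z (qintP2 n) = 0 := by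
    rw [map_mul, mul_eq_zero] at hz
    obtain h | h := hz
    · exact h
    · obtain ⟨c, hc⟩ := cyclo2_dvd_qintP2 hn1
      rw [hc, map_mul, h, zero_mul]
  have hpow : z ^ (2 * n) = 1 := by
    have := congrArg (Polynomial.aeval z) (qintP2_mul n)
    simp only [map_mul, hs, map_sub, map_one, map_pow, Polynomial.aeval_X, zero_mul] at this
    linear_combination this
  simp only [map_mul, map_add, map_one, map_pow, Polynomial.aeval_X, map_prod, mul_eq_zero,
    pow_eq_zero_iff two_ne_zero, pow_eq_zero_iff four_ne_zero, Finset.prod_eq_zero_iff] at hD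
  rcases hD with ((h | h) | h) | ⟨j, -, h⟩
  · rw [h, zero_pow (by omega)] at hpow
    exact zero_ne_one hpow
  · have hz1 : z = -1 := by linear_combination h
    rw [hz1] at hs
    simp [qintP2, pow_mul] at hs
    omega
  · rw [qintP2, Finset.sum_range_succ, map_add, ← qintP2, hs] at h
    simp [hpow] at h
  · have h1 : (z ^ 2) ^ (j + 1) = -1 := by linear_combination h
    have h2 : (z ^ (2 * n)) ^ (j + 1) = -1 := by
      rw [← hn.neg_one_pow (α := ℂ), ← h1]; ring
    rw [hpow] at h2
    norm_num at h2

theorem cyclo2_dvd_sub {m : ℕ} (hm : 0 < m) {B : Polynomial ℚ}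
    (hB : B * ∏ j ∈ Finset.range m, (1 - (Polynomial.X ^ 2) ^ (2 * j + 2)) =
      (∏ j ∈ Finset.range m, (1 + (Polynomial.X ^ 2) ^ (j + 1))) ^ 2 *
        ∏ j ∈ Finset.range m, (1 - (Polynomial.X ^ 2) ^ (2 * j + 1))) :
    cyclo2 (2 * m + 1) ∣
      Polynomial.X ^ (2 * m + 2) * (1 + Polynomial.X ^ 3) * qintP2 (2 * m + 2) ^ 2 *
          (∏ j ∈ Finset.range m, (1 + (Polynomial.X ^ 2) ^ (j + 1))) ^ 4 -
        (1 + Polynomial.X ^ (4 * m + 5)) * B ^ 2 := by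
  have hcop := isCoprime_cyclo2_prod m
  refine (hcop.pow_right (n := 2)).dvd_of_dvd_mul_left ?_
  have hs : AdjoinRoot.mk (cyclo2 (2 * m + 1)) (qintP2 (2 * m + 1)) = 0 :=
    AdjoinRoot.mk_eq_zero.mpr (cyclo2_dvd_qintP2 (by omega))
  have hpow : AdjoinRoot.mk (cyclo2 (2 * m + 1)) Polynomial.X ^ (2 * (2 * m + 1)) = 1 := by
    have := congrArg (AdjoinRoot.mk (cyclo2 (2 * m + 1))) (qintP2_mul (2 * m + 1))
    simp only [map_mul, hs, map_sub, map_one, map_pow, zero_mul] at this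
    linear_combination this
  have hW : AdjoinRoot.mk (cyclo2 (2 * m + 1)) (qintP2 (2 * m + 2)) = 1 := by
    rw [qintP2, Finset.sum_range_succ, map_add, ← qintP2, hs, map_pow, hpow, zero_add]
  have hO := sq_prod_one_sub_pow_odd _ m hpow
  have hB' := congrArg (AdjoinRoot.mk (cyclo2 (2 * m + 1))) hB
  rw [← AdjoinRoot.mk_eq_zero]
  simp only [map_mul, map_sub, map_add, map_pow, map_one, map_prod] at hB' hO ⊢
  rw [hW]
  generalize AdjoinRoot.mk (cyclo2 (2 * m + 1)) Polynomial.X = x at *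
  generalize ∏ j ∈ Finset.range m, (1 - (x ^ 2) ^ (2 * j + 2)) = P at *
  generalize ∏ j ∈ Finset.range m, (1 - (x ^ 2) ^ (2 * j + 1)) = O at *
  generalize ∏ j ∈ Finset.range m, (1 + (x ^ 2) ^ (j + 1)) = C at *
  generalize AdjoinRoot.mk (cyclo2 (2 * m + 1)) B = b at *
  have h5 : x ^ (4 * m + 5) = x ^ 3 := by
    rw [show 4 * m + 5 = 2 * (2 * m + 1) + 3 by ring, pow_add, hpow, one_mul]
  rw [h5]
  linear_combination -(1 + x ^ 3) * (b * P + C ^ 2 * O) * hB' - (1 + x ^ 3) * C ^ 4 * hO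

theorem exists_mul_prod_even_eq (m : ℕ) :
    ∃ B : Polynomial ℚ, B * ∏ j ∈ Finset.range m, (1 - (Polynomial.X ^ 2) ^ (2 * j + 2)) =
      (∏ j ∈ Finset.range m, (1 + (Polynomial.X ^ 2) ^ (j + 1))) ^ 2 *
        ∏ j ∈ Finset.range m, (1 - (Polynomial.X ^ 2) ^ (2 * j + 1)) := by
  obtain ⟨B, hB⟩ := prod_one_sub_pow_mul_dvd (Polynomial.X ^ 2 : Polynomial ℚ) m m
  refine ⟨B, ?_⟩
  rw [prod_one_sub_pow_two_mul] at hB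
  have hne : ∏ j ∈ Finset.range m, (1 - (Polynomial.X ^ 2) ^ (j + 1) : Polynomial ℚ) ≠ 0 :=
    Finset.prod_ne_zero_iff.mpr fun j _ => one_sub_X_sq_pow_ne_zero j
  rw [prod_one_sub_pow_even] at hB ⊢
  refine mul_left_cancel₀ (pow_ne_zero 2 hne) ?_
  linear_combination -(∏ j ∈ Finset.range m, (1 - (Polynomial.X ^ 2) ^ (j + 1) : Polynomial ℚ)) *
    (∏ j ∈ Finset.range m, (1 + (Polynomial.X ^ 2) ^ (j + 1) : Polynomial ℚ)) * hB

theorem algebraMap_qintP2 (n : ℕ) : algebraMap (Polynomial ℚ) (RatFunc ℚ) (qintP2 n) = qint2 n := by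
  simp only [qintP2, qint2, map_sum, map_pow, algebraMap_X_eq_q]

theorem qint2_mul (n : ℕ) : qint2 n * (1 - q ^ 2) = 1 - q ^ (2 * n) := by
  simp only [qint2, pow_mul]
  exact geom_sum_mul_neg _ _

theorem supercongruence_q2_half (n : ℕ) (hn : Odd n) (hn1 : 1 < n) :
    ∃ N D : Polynomial ℚ,
      IsCoprime D (qintP2 n * cyclo2 n) ∧
      algebraMap (Polynomial ℚ) (RatFunc ℚ) D *
          ((∑ k ∈ Finset.range ((n + 1) / 2 + 1),
              qintZ (4 * k - 1) * qpoch (q⁻¹ ^ 2) (q ^ 4) k ^ 2 / qpoch (q ^ 4) (q ^ 4) k ^ 2 *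
                q ^ (4 * k))
            - (-(q ^ n * (1 - q + q ^ 2)) * qint2 n ^ 2))
        = algebraMap (Polynomial ℚ) (RatFunc ℚ) N ∧
      qintP2 n ^ 2 * cyclo2 n ∣ N := by
  obtain ⟨m, rfl⟩ := id hn
  obtain ⟨B, hB⟩ := exists_mul_prod_even_eq m
  refine ⟨_, _, isCoprime_denominator hn hn1 m, ?_,
    mul_dvd_mul_left _ (cyclo2_dvd_sub (by omega) hB)⟩
  have hq := q_ne_zero
  have h1q := one_add_q_ne_zero
  have h2q : 1 - q ^ 2 ≠ 0 := one_sub_q_pow_ne_zero 1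
  have hO : qpoch (q ^ 2) (q ^ 4) m = ∏ j ∈ Finset.range m, (1 - (q ^ 2) ^ (2 * j + 1)) :=
    Finset.prod_congr rfl fun j _ => by ring
  have hP : qpoch (q ^ 4) (q ^ 4) m = ∏ j ∈ Finset.range m, (1 - (q ^ 2) ^ (2 * j + 2)) :=
    Finset.prod_congr rfl fun j _ => by ring
  have hP0 := qpoch_q_four_ne_zero m
  have hS := qint2_mul (2 * m + 1)
  have hW := qint2_mul (2 * m + 2)
  have hW0 : qint2 (2 * m + 2) ≠ 0 := by
    intro h
    rw [h, zero_mul] at hW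
    exact one_sub_q_pow_ne_zero (4 * m + 3) (by rw [hW]; ring)
  have hB' := congrArg (algebraMap (Polynomial ℚ) (RatFunc ℚ)) hB
  rw [show (2 * m + 1 + 1) / 2 + 1 = (m + 1) + 1 by omega, sum_qintZ_mul_qpoch, qpoch_succ,
    qpoch_succ, show 1 - q ^ 2 * (q ^ 4) ^ m = qint2 (2 * m + 1) * (1 - q ^ 2) by rw [hS]; ring,
    show 1 - q ^ 4 * (q ^ 4) ^ m = qint2 (2 * m + 2) * (1 - q ^ 2) by rw [hW]; ring]
  simp only [map_mul, map_sub, map_add, map_pow, map_one, map_prod, algebraMap_X_eq_q,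
    algebraMap_qintP2] at hB' ⊢
  rw [← hO, ← hP] at hB'
  generalize algebraMap (Polynomial ℚ) (RatFunc ℚ) B = b at *
  generalize ∏ j ∈ Finset.range m, (1 + (q ^ 2) ^ (j + 1)) = C at *
  generalize qpoch (q ^ 2) (q ^ 4) m = O at *
  generalize qpoch (q ^ 4) (q ^ 4) m = P at *
  rw [show 2 * m + 1 + 1 = 2 * m + 2 by ring]
  generalize qint2 (2 * m + 1) = S at *
  generalize qint2 (2 * m + 2) = W at *
  obtain rfl : b = C ^ 2 * O / P := by field_simp; linear_combination hB'
  field_simp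
  ring
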